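/- Let α ∈ (−1, 1) and let W : ℝ → [0,∞) be measurable with M := sup_{z ∈ ℤ} ∫_z^{z+1} W(p) dp < ∞ and W(p) ≤ C₀ |p|^α for all p with 0 < |p| ≤ R₀, for some constants C₀, R₀ > 0. Then there exist C > 0 and λ₀ ∈ (0, 1] such that for all λ ∈ (0, λ₀] and all p ∈ ℝ with |p| ≤ √λ, ∫_ℝ W(q) / (λ + (p+q)²/2) dq ≤ C · λ^{(α−1)/2}. -/

import Mathlib

open MeasureTheory ENNReal

/-- The profile `|t|^α / (1+t²)` is integrable. -/
lemma aux_int (α : ℝ) (hα : -1 < α) (hα' : α < 1) :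
    Integrable (fun t : ℝ => |t| ^ α / (1 + t ^ 2)) := by
  have hmeas : Measurable (fun t : ℝ => |t| ^ α / (1 + t ^ 2)) := by fun_prop
  have h1 : IntegrableOn (fun t : ℝ => |t| ^ α / (1 + t ^ 2)) (Set.Ioc 0 1) := by
    have h := (intervalIntegral.intervalIntegrable_rpow' (a := 0) (b := 1) hα)
    rw [intervalIntegrable_iff_integrableOn_Ioc_of_le zero_le_one] at h
    refine Integrable.mono' h hmeas.aestronglyMeasurable ?_
    refine (ae_restrict_iff' measurableSet_Ioc).2 (Filter.Eventually.of_forall ?_)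
    intro t ht
    rw [Real.norm_of_nonneg (by positivity), abs_of_pos ht.1]
    exact div_le_self (Real.rpow_nonneg ht.1.le _) (by nlinarith [sq_nonneg t])
  have h2 : IntegrableOn (fun t : ℝ => |t| ^ α / (1 + t ^ 2)) (Set.Ioi 1) := by
    have h := integrableOn_Ioi_rpow_of_lt (a := α - 2) (c := 1) (by linarith) one_pos
    refine Integrable.mono' h hmeas.aestronglyMeasurable ?_
    refine (ae_restrict_iff' measurableSet_Ioi).2 (Filter.Eventually.of_forall ?_)
    intro t ht
    have ht0 : 0 < t := lt_trans one_pos ht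
    rw [Real.norm_of_nonneg (by positivity), abs_of_pos ht0, Real.rpow_sub ht0]
    have : t ^ (2:ℝ) = t ^ 2 := by exact_mod_cast Real.rpow_natCast t 2
    rw [this]
    exact div_le_div_of_nonneg_left (Real.rpow_nonneg ht0.le _) (by positivity) (by linarith)
  have h3 : IntegrableOn (fun t : ℝ => |t| ^ α / (1 + t ^ 2)) (Set.Ioi 0) := by
    rw [← Set.Ioc_union_Ioi_eq_Ioi (zero_le_one (α := ℝ))]
    exact h1.union h2
  have h4 := (integrable_indicator_iff measurableSet_Ioi).2 h3
  refine Integrable.mono' (h4.add h4.comp_neg) hmeas.aestronglyMeasurable ?_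
  filter_upwards [Measure.ae_ne volume (0:ℝ)] with t ht
  rw [Real.norm_of_nonneg (by positivity)]
  rcases lt_or_gt_of_ne ht with h | h
  · simp [Set.indicator, h, not_lt.2 h.le]
  · simp [Set.indicator, h, not_lt.2 h.le]

lemma aux_scale (α : ℝ) (hα : -1 < α) (hα' : α < 1) (lam : ℝ) (hl : 0 < lam) :
    ∫⁻ q : ℝ, ENNReal.ofReal (|q| ^ α / (lam + q ^ 2)) =
      ENNReal.ofReal ((∫ t : ℝ, |t| ^ α / (1 + t ^ 2)) * lam ^ ((α - 1) / 2)) := by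
  have hI := aux_int α hα hα'
  have hs : 0 < Real.sqrt lam := Real.sqrt_pos.2 hl
  have hfun : (fun q : ℝ => |q| ^ α / (lam + q ^ 2)) = fun q =>
      (Real.sqrt lam ^ α / lam) * (|q / Real.sqrt lam| ^ α / (1 + (q / Real.sqrt lam) ^ 2)) := by
    funext q
    rw [abs_div, abs_of_pos hs, Real.div_rpow (abs_nonneg _) hs.le, div_pow, Real.sq_sqrt hl.le]
    have : 0 < Real.sqrt lam ^ α := Real.rpow_pos_of_pos hs _
    field_simp
  have hJ : Integrable (fun q : ℝ => |q| ^ α / (lam + q ^ 2)) := by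
    rw [hfun]
    exact (hI.comp_div hs.ne').const_mul _
  rw [← ofReal_integral_eq_lintegral_ofReal hJ
    (Filter.Eventually.of_forall fun q => by show (0:ℝ) ≤ _; positivity)]
  congr 1
  rw [hfun, integral_const_mul,
    Measure.integral_comp_div (fun t : ℝ => |t| ^ α / (1 + t ^ 2)) (Real.sqrt lam),
    abs_of_pos hs, smul_eq_mul]
  have : lam ^ ((α - 1) / 2) = Real.sqrt lam ^ α / lam * Real.sqrt lam := by
    rw [Real.sqrt_eq_rpow, ← Real.rpow_mul hl.le]
    nth_rewrite 3 [← Real.rpow_one lam]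
    rw [← Real.rpow_sub hl, ← Real.rpow_add hl]
    congr 1; ring
  rw [this]; ring

lemma aux_tail (W : ℝ → ℝ) (hW0 : ∀ p, 0 ≤ W p) (M : ℝ)
    (hM : ∀ z : ℤ, ∫⁻ p in Set.Ioc (z : ℝ) (z + 1), ENNReal.ofReal (W p) ≤ ENNReal.ofReal M) :
    ∫⁻ q : ℝ, ENNReal.ofReal (W q / (1 + q ^ 2)) ≠ ∞ := by
  have hsum : Summable (fun z : ℤ => 3 / (1 + (z : ℝ) ^ 2)) := by
    have h := ((Real.summable_one_div_int_pow (p := 2)).2 (by norm_num)).mul_left 3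
    refine Summable.of_norm_bounded_eventually h ?_
    filter_upwards [(Set.finite_singleton (0:ℤ)).compl_mem_cofinite] with z hz
    have hz' : (z:ℝ) ≠ 0 := by exact_mod_cast hz
    rw [Real.norm_of_nonneg (by positivity), mul_one_div]
    exact div_le_div_of_nonneg_left (by norm_num) (by positivity) (by linarith)
  have key : ∫⁻ q : ℝ, ENNReal.ofReal (W q / (1 + q ^ 2)) ≤
      ∑' z : ℤ, ENNReal.ofReal (3 / (1 + (z : ℝ) ^ 2)) * ENNReal.ofReal M := by
    rw [← setLIntegral_univ, ← iUnion_Ioc_intCast ℝ]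
    refine (lintegral_iUnion_le _ _).trans (ENNReal.tsum_le_tsum fun z => ?_)
    calc ∫⁻ q in Set.Ioc (z:ℝ) (z+1), ENNReal.ofReal (W q / (1 + q ^ 2))
        ≤ ∫⁻ q in Set.Ioc (z:ℝ) (z+1),
            ENNReal.ofReal (3 / (1 + (z : ℝ) ^ 2)) * ENNReal.ofReal (W q) := by
          refine setLIntegral_mono' measurableSet_Ioc fun q hq => ?_
          rw [← ENNReal.ofReal_mul (by positivity)]
          refine ENNReal.ofReal_le_ofReal ?_
          rw [div_mul_eq_mul_div, div_le_div_iff₀ (by positivity) (by positivity)]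
          have h1 : 1 + (z:ℝ)^2 ≤ 3 * (1 + q^2) := by
            nlinarith [hq.1, hq.2, sq_nonneg (2 * q - z), sq_nonneg (q - z)]
          nlinarith [mul_le_mul_of_nonneg_left h1 (hW0 q)]
      _ = ENNReal.ofReal (3 / (1 + (z : ℝ) ^ 2)) *
            ∫⁻ q in Set.Ioc (z:ℝ) (z+1), ENNReal.ofReal (W q) :=
          lintegral_const_mul' _ _ ENNReal.ofReal_ne_top
      _ ≤ _ := by gcongr; exact hM z
  refine ne_top_of_le_ne_top ?_ key
  rw [ENNReal.tsum_mul_right]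
  refine ENNReal.mul_ne_top ?_ ENNReal.ofReal_ne_top
  exact hsum.tsum_ofReal_ne_top

/-- The 'claim' inside the proof of the superdiffusivity Theorem 1.4: the inner integral
`∫ W(q)/(λ + (p+q)²/2) dq` is bounded by `C λ^{(α−1)/2}` uniformly over `|p| ≤ √λ`
for all small `λ`. -/
theorem stmt_11 (α : ℝ) (hα : -1 < α) (hα' : α < 1)
    (W : ℝ → ℝ) (hW : Measurable W) (hW0 : ∀ p, 0 ≤ W p)
    (M : ℝ)
    (hM : ∀ z : ℤ, ∫⁻ p in Set.Ioc (z : ℝ) (z + 1), ENNReal.ofReal (W p) ≤ ENNReal.ofReal M)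
    (C₀ R₀ : ℝ) (hC₀ : 0 < C₀) (hR₀ : 0 < R₀)
    (hWb : ∀ p : ℝ, 0 < |p| → |p| ≤ R₀ → W p ≤ C₀ * |p| ^ α) :
    ∃ C : ℝ, 0 < C ∧ ∃ lam₀ : ℝ, 0 < lam₀ ∧ lam₀ ≤ 1 ∧
      ∀ lam : ℝ, 0 < lam → lam ≤ lam₀ → ∀ p : ℝ, |p| ≤ Real.sqrt lam →
        ∫⁻ q, ENNReal.ofReal (W q / (lam + (p + q) ^ 2 / 2))
          ≤ ENNReal.ofReal (C * lam ^ ((α - 1) / 2)) := by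
  have hT := aux_tail W hW0 M hM
  set T := ∫⁻ q : ℝ, ENNReal.ofReal (W q / (1 + q ^ 2)) with hTdef
  set K := ∫ t : ℝ, |t| ^ α / (1 + t ^ 2) with hK
  have hK0 : 0 ≤ K := integral_nonneg fun t => by show (0:ℝ) ≤ _; positivity
  set D : ℝ := 4 * (1 + 1 / R₀ ^ 2) with hD
  have hD0 : 0 < D := by positivity
  have hT0 : 0 ≤ T.toReal := ENNReal.toReal_nonneg
  refine ⟨4 * C₀ * K + D * T.toReal + 1, by positivity, 1, one_pos, le_rfl, ?_⟩
  intro lam hl hl1 p hp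
  have hp2 : p ^ 2 ≤ lam := by
    rw [← Real.sq_sqrt hl.le, ← sq_abs p]
    gcongr
  have hpt : ∀ q : ℝ, q ≠ 0 → ENNReal.ofReal (W q / (lam + (p + q) ^ 2 / 2)) ≤
      ENNReal.ofReal (4 * C₀) * ENNReal.ofReal (|q| ^ α / (lam + q ^ 2)) +
      ENNReal.ofReal D * ENNReal.ofReal (W q / (1 + q ^ 2)) := by
    intro q hq
    have hq2 : 0 < q ^ 2 := by positivity
    have hden : (lam + q ^ 2) / 4 ≤ lam + (p + q) ^ 2 / 2 := by
      nlinarith [sq_nonneg (2 * p + q)]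
    have h1 : W q / (lam + (p + q) ^ 2 / 2) ≤ W q / ((lam + q ^ 2) / 4) :=
      div_le_div_of_nonneg_left (hW0 q) (by positivity) hden
    rw [← ENNReal.ofReal_mul (by positivity), ← ENNReal.ofReal_mul hD0.le]
    rcases le_or_gt |q| R₀ with hqR | hqR
    · refine le_trans (ENNReal.ofReal_le_ofReal ?_) le_self_add
      refine h1.trans ?_
      have := hWb q (abs_pos.2 hq) hqR
      rw [← mul_div_assoc, div_le_div_iff₀ (by positivity) (by positivity)]
      nlinarith [mul_le_mul_of_nonneg_right this (show 0 ≤ lam + q ^ 2 by positivity)]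
    · refine le_trans (ENNReal.ofReal_le_ofReal ?_) le_add_self
      refine h1.trans ?_
      have hRq : R₀ ^ 2 ≤ q ^ 2 := by rw [← sq_abs q]; gcongr
      have h2 : 1 ≤ q ^ 2 / R₀ ^ 2 := by rwa [one_le_div (by positivity)]
      have h3 : 4 * (1 + q ^ 2) ≤ D * (lam + q ^ 2) := by
        have : D * (lam + q ^ 2) = 4 * (q ^ 2 + q ^ 2 / R₀ ^ 2) + D * lam := by
          rw [hD]; ring
        nlinarith [mul_pos hD0 hl]
      rw [← mul_div_assoc, div_le_div_iff₀ (by positivity) (by positivity)]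
      nlinarith [mul_le_mul_of_nonneg_left h3 (hW0 q)]
  have hpow : 1 ≤ lam ^ ((α - 1) / 2) :=
    Real.one_le_rpow_of_pos_of_le_one_of_nonpos hl hl1 (by linarith)
  calc ∫⁻ q, ENNReal.ofReal (W q / (lam + (p + q) ^ 2 / 2))
      ≤ ∫⁻ q, (ENNReal.ofReal (4 * C₀) * ENNReal.ofReal (|q| ^ α / (lam + q ^ 2)) +
          ENNReal.ofReal D * ENNReal.ofReal (W q / (1 + q ^ 2))) := by
        refine lintegral_mono_ae ?_
        filter_upwards [Measure.ae_ne volume (0:ℝ)] with q hq using hpt q hq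
    _ = ENNReal.ofReal (4 * C₀) * ENNReal.ofReal (K * lam ^ ((α - 1) / 2)) +
          ENNReal.ofReal D * T := by
        rw [lintegral_add_left (by fun_prop), lintegral_const_mul' _ _ ENNReal.ofReal_ne_top,
          lintegral_const_mul' _ _ ENNReal.ofReal_ne_top, aux_scale α hα hα' lam hl]
    _ = ENNReal.ofReal (4 * C₀ * (K * lam ^ ((α - 1) / 2)) + D * T.toReal) := by
        rw [ENNReal.ofReal_add (by positivity) (by positivity),
          ENNReal.ofReal_mul (p := 4 * C₀) (by positivity), ENNReal.ofReal_mul hD0.le,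
          ENNReal.ofReal_toReal hT]
    _ ≤ _ := by
        refine ENNReal.ofReal_le_ofReal ?_
        nlinarith [mul_le_mul_of_nonneg_left hpow (mul_nonneg hD0.le hT0)]
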